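/- Let N ≥ 2 be an even integer, k = N/2, and let f : [0,1) → [0,∞) be continuous with f(0) = 0 and f(r) > 0 for r ∈ (0,1). Assume there exists σ > 1 such that limsup_{r→0⁺} f(r)·|ln r|^σ < ∞. Then the supremum MT_N(f) = sup { ∫_B exp(μ_N |u(x)|^{(N+2)/N + f(|x|)}) dx : u ∈ Φ^k_{0,rad}(B), ‖u‖_{Φ^k_0} = 1 } is finite. -/

import Mathlib

open MeasureTheory Real Set Filter
open scoped ENNReal

/-- Surface area of the unit sphere in `ℝ^N` (equals `N` times the volume of the unit ball). -/
noncomputable def omegaS (N : ℕ) : ℝ :=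
  N * (volume (Metric.ball (0 : EuclideanSpace ℝ (Fin N)) 1)).toReal

/-- The normalising constant `c_N = ω_{N-1} · binom(N,k) / N`. -/
noncomputable def cN (N k : ℕ) : ℝ := omegaS N * (N.choose k) / N

/-- The critical constant `μ_N = N · (ω_{N-1} · binom(N-1,k-1) / k)^{2/N}`. -/
noncomputable def muN (N k : ℕ) : ℝ :=
  N * (omegaS N * ((N - 1).choose (k - 1)) / k) ^ ((2 : ℝ) / N)

/-- Radial profile of a radially symmetric `k`-admissible function on the unit ball:
`w ∈ C²([0,1])`, `w(1) = 0`, and for each `1 ≤ j ≤ k` the function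
`r ↦ r^{N-j} (w'(r))^j` is non-decreasing on `(0,1)`. -/
structure KAdmRad (N k : ℕ) (w : ℝ → ℝ) : Prop where
  smooth : ContDiffOn ℝ 2 w (Icc 0 1)
  bdry : w 1 = 0
  hess : ∀ j : ℕ, 1 ≤ j → j ≤ k →
    MonotoneOn (fun r => r ^ (N - j) * (deriv w r) ^ j) (Ioo (0:ℝ) 1)

/-- The norm `‖u‖_{Φᵏ₀} = (c_N ∫₀¹ r^{N-k} |w'|^{k+1} dr)^{1/(k+1)}` of the radial
function `u(x) = w(|x|)`. -/
noncomputable def normPhi (N k : ℕ) (w : ℝ → ℝ) : ℝ :=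
  (cN N k * ∫ r in Ioo (0:ℝ) 1, r ^ (N - k) * |deriv w r| ^ (k + 1)) ^ (1 / (k + 1 : ℝ))

/-- The supercritical Trudinger–Moser functional on the unit ball of `ℝ^N` for the
radial function `u(x) = w(|x|)`. -/
noncomputable def ballIntegral (N k : ℕ) (f w : ℝ → ℝ) : ℝ≥0∞ :=
  ∫⁻ x in Metric.ball (0 : EuclideanSpace ℝ (Fin N)) 1,
    ENNReal.ofReal (exp (muN N k * |w ‖x‖| ^ (((N : ℝ) + 2) / N + f ‖x‖)))

theorem add_pow_succ_le_of_weights (k : ℕ) {x y L z : ℝ} (hx : 0 ≤ x) (hy : 0 ≤ y) (hL : 0 < L)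
    (hz : 0 < z) :
    (x + y) ^ (k + 1) ≤ (L + z) ^ k * (x ^ (k + 1) / L ^ k + y ^ (k + 1) / z ^ k) := by
  have h := (convexOn_pow (𝕜 := ℝ) (k + 1)).2 (mem_Ici.2 (div_nonneg hx hL.le))
    (mem_Ici.2 (div_nonneg hy hz.le)) (div_nonneg hL.le (add_pos hL hz).le)
    (div_nonneg hz.le (add_pos hL hz).le) (by field_simp)
  simp only [smul_eq_mul] at h
  have e1 : L / (L + z) * (x / L) + z / (L + z) * (y / z) = (x + y) / (L + z) := by field_simp
  rw [e1, div_pow, div_le_iff₀ (by positivity)] at h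
  refine h.trans_eq ?_
  rw [div_pow, div_pow]
  field_simp
  ring

theorem rpow_succ_div_pow (k : ℕ) (hk : 0 < k) {v : ℝ} (hv : 0 ≤ v) :
    (v ^ (((k : ℝ) + 1) / k)) ^ k = v ^ (k + 1) := by
  have : (k : ℝ) ≠ 0 := by positivity
  rw [← rpow_natCast, ← rpow_mul hv, div_mul_cancel₀ _ this]
  exact_mod_cast rpow_natCast v (k + 1)

/-- Two-point comparison behind Moser's inequality: if the deficit at the outer point is a small
fraction of `L`, the two deficits together control the logarithmic distance `y`. -/
theorem moser_two_point (k : ℕ) (hk : 0 < k) {v₁ v₂ d L y a : ℝ} (hv₁ : 0 ≤ v₁) (hv₂ : 0 ≤ v₂)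
    (hd : 0 ≤ d) (hL : 0 < L) (hy : 0 ≤ y) (ha : a ≤ 1) (h₁ : v₁ ≤ v₂ + d)
    (h₂ : v₂ ^ (k + 1) ≤ L ^ k * a) (h₃ : d ^ (k + 1) ≤ y ^ k * (1 - a))
    (hε : 2 ^ k * k * (L - v₂ ^ (((k : ℝ) + 1) / k)) ≤ L / 2) :
    y / 4 ≤ (L + y - v₁ ^ (((k : ℝ) + 1) / k)) + 2 ^ k * k * (L - v₂ ^ (((k : ℝ) + 1) / k)) := by
  have e₁ := rpow_succ_div_pow k hk hv₁
  have e₂ := rpow_succ_div_pow k hk hv₂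
  have p₁ : 0 ≤ v₁ ^ (((k : ℝ) + 1) / k) := by positivity
  have p₂ : 0 ≤ v₂ ^ (((k : ℝ) + 1) / k) := by positivity
  have hmono : v₁ ≤ v₂ → v₁ ^ (((k : ℝ) + 1) / k) ≤ v₂ ^ (((k : ℝ) + 1) / k) := fun h => by
    gcongr
  generalize v₁ ^ (((k : ℝ) + 1) / k) = P₁ at *
  generalize v₂ ^ (((k : ℝ) + 1) / k) = P₂ at *
  have hk0 : k ≠ 0 := hk.ne'
  have hK : (0 : ℝ) ≤ 2 ^ k * k := by positivity
  have hPL : P₂ ≤ L := by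
    refine le_of_pow_le_pow_left₀ hk0 hL.le ?_
    rw [e₂]
    exact h₂.trans (mul_le_of_le_one_right (by positivity) ha)
  rcases hy.eq_or_lt with rfl | hy
  · have hd0 : d = 0 := by
      rw [zero_pow hk0, zero_mul] at h₃
      exact pow_eq_zero_iff (by omega) |>.1 (le_antisymm h₃ (by positivity))
    have := hmono (by linarith)
    have := mul_nonneg hK (sub_nonneg.2 hPL)
    linarith
  set θ := P₂ / L with hθ
  have hPθ : P₂ = θ * L := by rw [hθ]; field_simp
  have hθ0 : 0 ≤ θ := by positivity
  have hθ1 : θ ≤ 1 := (div_le_one hL).2 hPL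
  have hθa : θ ^ k ≤ a := by
    rw [hθ, div_pow, e₂, div_le_iff₀ (by positivity)]
    linarith
  have hbern : 1 + (k : ℝ) * (θ - 1) ≤ θ ^ k := by
    simpa using one_add_mul_le_pow (a := θ - 1) (by linarith) k
  set x := 2 ^ k * k * (1 - θ) with hx
  have hx0 : 0 ≤ x := mul_nonneg hK (by linarith)
  have hxL : 2 ^ k * k * (L - P₂) = x * L := by rw [hx, hPθ]; ring
  have hx1 : x ≤ 1 / 2 := by
    rw [hxL] at hε
    by_contra! h
    nlinarith
  have key : P₁ ^ k ≤ ((L + y / 2) * (1 + x)) ^ k := by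
    rw [e₁]
    calc v₁ ^ (k + 1) ≤ (v₂ + d) ^ (k + 1) := by gcongr
      _ ≤ (L + y / 2) ^ k * (v₂ ^ (k + 1) / L ^ k + d ^ (k + 1) / (y / 2) ^ k) :=
        add_pow_succ_le_of_weights k hv₂ hd hL (by positivity)
      _ ≤ (L + y / 2) ^ k * (1 + x) := by
        gcongr ?_ * (?_ + ?_)
        · rw [div_le_one (by positivity)]
          exact h₂.trans (mul_le_of_le_one_right (by positivity) ha)
        · rw [div_le_iff₀ (by positivity)]
          refine h₃.trans ?_
          have : x * (y / 2) ^ k = y ^ k * (k * (1 - θ)) := by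
            rw [hx, div_pow]; field_simp
          rw [this]
          gcongr
          linarith
      _ ≤ ((L + y / 2) * (1 + x)) ^ k := by
        rw [mul_pow]
        gcongr
        exact le_self_pow₀ (by linarith) hk0
  have := le_of_pow_le_pow_left₀ hk0 (by positivity) key
  rw [hxL]
  nlinarith

/-- Hölder's inequality on `[r₁, r₂]` against the weight `s ^ k`, in integer powers. -/
theorem integral_abs_pow_le_log_pow_mul (k : ℕ) (hk : 0 < k) {g : ℝ → ℝ} {r₁ r₂ : ℝ} (h₁ : 0 < r₁)
    (h₁₂ : r₁ ≤ r₂) (hg : ContinuousOn g (Icc r₁ r₂)) :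
    (∫ s in r₁..r₂, |g s|) ^ (k + 1) ≤
      log (r₂ / r₁) ^ k * ∫ s in r₁..r₂, s ^ k * |g s| ^ (k + 1) := by
  have hk' : (0 : ℝ) < k := by positivity
  have hpos : ∀ s ∈ Icc r₁ r₂, 0 < s := fun s hs => h₁.trans_le hs.1
  have hmeas : MeasurableSet (Ioc r₁ r₂) := measurableSet_Ioc
  have memLp : ∀ (q : ℝ≥0∞) (φ : ℝ → ℝ), ContinuousOn φ (Icc r₁ r₂) →
      MemLp φ q (volume.restrict (Ioc r₁ r₂)) := fun q φ hφ => by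
    obtain ⟨C, hC⟩ := isCompact_Icc.exists_bound_of_continuousOn hφ
    refine MemLp.of_bound ((hφ.mono Ioc_subset_Icc_self).aestronglyMeasurable hmeas) C ?_
    filter_upwards [ae_restrict_mem hmeas] with x hx using hC x (Ioc_subset_Icc_self hx)
  have hconj : (((k : ℝ) + 1) / k).HolderConjugate ((k : ℝ) + 1) := by
    rw [Real.holderConjugate_iff]
    refine ⟨by rw [lt_div_iff₀ hk']; linarith, by field_simp⟩
  have hcont : ∀ p : ℝ, ContinuousOn (fun s : ℝ => s ^ p) (Icc r₁ r₂) := fun p =>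
    continuousOn_id.rpow_const fun s hs => Or.inl (hpos s hs).ne'
  have key := integral_mul_le_Lp_mul_Lq_of_nonneg hconj
    (μ := volume.restrict (Ioc r₁ r₂)) (f := fun s => s ^ (-((k : ℝ) / (k + 1))))
    (g := fun s => s ^ ((k : ℝ) / (k + 1)) * |g s|)
    (by filter_upwards [ae_restrict_mem hmeas] with s hs
        exact rpow_nonneg (hpos s (Ioc_subset_Icc_self hs)).le _)
    (by filter_upwards [ae_restrict_mem hmeas] with s hs
        exact mul_nonneg (rpow_nonneg (hpos s (Ioc_subset_Icc_self hs)).le _) (abs_nonneg _))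
    (memLp _ _ (hcont _)) (memLp _ _ ((hcont _).mul hg.abs))
  rw [intervalIntegral.integral_of_le h₁₂, intervalIntegral.integral_of_le h₁₂]
  have e₀ : ∫ s in Ioc r₁ r₂, s ^ (-((k : ℝ) / (k + 1))) * (s ^ ((k : ℝ) / (k + 1)) * |g s|) =
      ∫ s in Ioc r₁ r₂, |g s| := setIntegral_congr_fun hmeas fun s hs => by
    have := hpos s (Ioc_subset_Icc_self hs)
    rw [← mul_assoc, ← rpow_add this, neg_add_cancel, rpow_zero, one_mul]
  have e₁ : ∫ s in Ioc r₁ r₂, (s ^ (-((k : ℝ) / (k + 1)))) ^ (((k : ℝ) + 1) / k) =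
      log (r₂ / r₁) := by
    rw [← integral_inv_of_pos h₁ (h₁.trans_le h₁₂), intervalIntegral.integral_of_le h₁₂]
    refine setIntegral_congr_fun hmeas fun s hs => ?_
    have := hpos s (Ioc_subset_Icc_self hs)
    rw [← rpow_mul this.le, ← rpow_neg_one]
    congr 1
    field_simp
  have e₂ : ∫ s in Ioc r₁ r₂, (s ^ ((k : ℝ) / (k + 1)) * |g s|) ^ ((k : ℝ) + 1) =
      ∫ s in Ioc r₁ r₂, s ^ k * |g s| ^ (k + 1) := setIntegral_congr_fun hmeas fun s hs => by
    have := hpos s (Ioc_subset_Icc_self hs)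
    rw [mul_rpow (by positivity) (by positivity), ← rpow_mul this.le, div_mul_cancel₀ _ (by positivity),
      rpow_natCast]
    congr 1
    exact_mod_cast rpow_natCast |g s| (k + 1)
  rw [e₀, e₁, e₂] at key
  have hlog : 0 ≤ log (r₂ / r₁) := log_nonneg ((one_le_div h₁).2 h₁₂)
  have hint : 0 ≤ ∫ s in Ioc r₁ r₂, s ^ k * |g s| ^ (k + 1) :=
    setIntegral_nonneg hmeas fun s hs => by
      have := hpos s (Ioc_subset_Icc_self hs)
      positivity
  refine (pow_le_pow_left₀ (setIntegral_nonneg hmeas fun s _ => abs_nonneg _) key (k + 1)).trans_eq ?_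
  rw [mul_pow, ← rpow_natCast, ← rpow_mul hlog, ← rpow_natCast (_ ^ (1 / ((k : ℝ) + 1))),
    ← rpow_mul hint, ← rpow_natCast (log _)]
  push_cast
  congr 1
  · congr 1
    field_simp
  · rw [one_div_mul_cancel (by positivity), rpow_one]

theorem cN_pos (N k : ℕ) (hk : 0 < k) (hN : N = 2 * k) : 0 < cN N k := by
  have hN0 : 0 < N := by omega
  have : Nonempty (Fin N) := ⟨⟨0, hN0⟩⟩
  have hvol : 0 < (volume (Metric.ball (0 : EuclideanSpace ℝ (Fin N)) 1)).toReal :=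
    ENNReal.toReal_pos (Metric.measure_ball_pos _ _ one_pos).ne' measure_ball_lt_top.ne
  have hch : 0 < N.choose k := Nat.choose_pos (by omega)
  unfold cN omegaS
  positivity

theorem muN_eq (N k : ℕ) (hk : 0 < k) (hN : N = 2 * k) :
    muN N k = N * cN N k ^ ((1 : ℝ) / k) := by
  have hch : ((N - 1).choose (k - 1) : ℝ) / k = (N.choose k : ℝ) / N := by
    obtain ⟨j, rfl⟩ : ∃ j, k = j + 1 := ⟨k - 1, by omega⟩
    obtain ⟨m, rfl⟩ : ∃ m, N = m + 1 := ⟨N - 1, by omega⟩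
    rw [div_eq_div_iff (by positivity) (by positivity)]
    have := Nat.add_one_mul_choose_eq m j
    simp only [Nat.add_sub_cancel]
    push_cast at this ⊢
    rw [mul_comm]
    exact_mod_cast this
  have he : (2 : ℝ) / N = 1 / k := by
    subst hN
    push_cast
    field_simp
  unfold muN cN
  rw [he, mul_div_assoc, mul_div_assoc, hch]

theorem KAdmRad.exists_energy {N k : ℕ} (hk : 0 < k) (hN : N = 2 * k) {w : ℝ → ℝ}
    (hw : KAdmRad N k w) (hnorm : normPhi N k w = 1) :
    ∃ E : ℝ → ℝ, E 1 = 0 ∧ (∀ r ∈ Ioc (0 : ℝ) 1, E r ≤ 1) ∧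
      ∀ r₁ r₂, 0 < r₁ → r₁ ≤ r₂ → r₂ ≤ 1 →
        cN N k * |w r₁ - w r₂| ^ (k + 1) ≤ log (r₂ / r₁) ^ k * (E r₁ - E r₂) := by
  have hc := cN_pos N k hk hN
  set G := derivWithin w (Icc 0 1) with hG
  have hGc : ContinuousOn G (Icc 0 1) :=
    hw.smooth.continuousOn_derivWithin (uniqueDiffOn_Icc zero_lt_one) (by norm_num)
  have hGd : ∀ r ∈ Ioo (0 : ℝ) 1, G r = deriv w r := fun r hr =>
    derivWithin_of_mem_nhds (Icc_mem_nhds hr.1 hr.2)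
  have hderiv : ∀ r ∈ Ioo (0 : ℝ) 1, HasDerivAt w (G r) r := fun r hr => by
    rw [hGd r hr]
    exact ((hw.smooth.differentiableOn (by norm_num)).differentiableAt
      (Icc_mem_nhds hr.1 hr.2)).hasDerivAt
  set φ : ℝ → ℝ := fun s => s ^ k * |G s| ^ (k + 1) with hφ
  have hφc : ContinuousOn φ (Icc 0 1) := by
    refine (continuousOn_id.pow k).mul (hGc.abs.pow (k + 1))
  have hφi : ∀ a ∈ Icc (0 : ℝ) 1, ∀ b ∈ Icc (0 : ℝ) 1, IntervalIntegrable φ volume a b :=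
    fun a ha b hb => (hφc.mono ((convex_Icc (0 : ℝ) 1).ordConnected.uIcc_subset ha hb)).intervalIntegrable
  have htotal : cN N k * ∫ s in (0 : ℝ)..1, φ s = 1 := by
    have hnn : 0 ≤ cN N k * ∫ s in (0 : ℝ)..1, φ s := by
      refine mul_nonneg hc.le (intervalIntegral.integral_nonneg zero_le_one fun s hs => ?_)
      have := hs.1
      positivity
    have e : ∫ r in Ioo (0 : ℝ) 1, r ^ (N - k) * |deriv w r| ^ (k + 1) = ∫ s in (0 : ℝ)..1, φ s := by
      rw [intervalIntegral.integral_of_le zero_le_one, integral_Ioc_eq_integral_Ioo]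
      refine setIntegral_congr_fun measurableSet_Ioo fun s hs => ?_
      simp only [hφ]
      rw [hGd s hs, show N - k = k by omega]
    rw [normPhi, e] at hnorm
    exact (rpow_left_inj hnn zero_le_one (by positivity)).1 (hnorm.trans (one_rpow _).symm)
  refine ⟨fun r => cN N k * ∫ s in r..1, φ s, by simp, fun r hr => ?_, fun r₁ r₂ h₁ h₁₂ h₂ => ?_⟩
  · rw [← intervalIntegral.integral_add_adjacent_intervals
      (hφi 0 (by simp) r ⟨hr.1.le, hr.2⟩) (hφi r ⟨hr.1.le, hr.2⟩ 1 (by simp))] at htotal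
    have : 0 ≤ ∫ s in (0 : ℝ)..r, φ s := intervalIntegral.integral_nonneg hr.1.le fun s hs => by
      have := hs.1
      positivity
    simp only
    nlinarith
  · have hsub : Icc r₁ r₂ ⊆ Icc 0 1 := Icc_subset_Icc h₁.le h₂
    have hftc : ∫ s in r₁..r₂, G s = w r₂ - w r₁ :=
      intervalIntegral.integral_eq_sub_of_hasDerivAt_of_le h₁₂ (hw.smooth.continuousOn.mono hsub)
        (fun s hs => hderiv s ⟨h₁.trans hs.1, hs.2.trans_le h₂⟩)
        ((hGc.mono hsub).intervalIntegrable_of_Icc h₁₂)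
    have hle : |w r₁ - w r₂| ≤ ∫ s in r₁..r₂, |G s| := by
      rw [abs_sub_comm, ← hftc]
      exact intervalIntegral.abs_integral_le_integral_abs h₁₂
    have hsplit := intervalIntegral.integral_add_adjacent_intervals
      (hφi r₁ (hsub ⟨le_rfl, h₁₂⟩) r₂ (hsub ⟨h₁₂, le_rfl⟩)) (hφi r₂ (hsub ⟨h₁₂, le_rfl⟩) 1 (by simp))
    have hH := integral_abs_pow_le_log_pow_mul k hk h₁ h₁₂ (hGc.mono hsub)
    calc cN N k * |w r₁ - w r₂| ^ (k + 1)
        ≤ cN N k * (log (r₂ / r₁) ^ k * ∫ s in r₁..r₂, φ s) := by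
          gcongr
          exact (pow_le_pow_left₀ (abs_nonneg _) hle _).trans hH
      _ = _ := by simp only [← hsplit]; ring

theorem muN_pos (N k : ℕ) (hk : 0 < k) (hN : N = 2 * k) : 0 < muN N k := by
  have := cN_pos N k hk hN
  have : 0 < N := by omega
  rw [muN_eq N k hk hN]
  positivity

theorem KAdmRad.deficit {N k : ℕ} (hk : 0 < k) (hN : N = 2 * k) {w : ℝ → ℝ}
    (hw : KAdmRad N k w) (hnorm : normPhi N k w = 1) {h : ℝ → ℝ}
    (hh : ∀ r, h r = -(N * log r) - muN N k * |w r| ^ (((k : ℝ) + 1) / k)) :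
    (∀ r ∈ Ioo (0 : ℝ) 1, 0 ≤ h r) ∧ ∀ r₁ r₂, 0 < r₁ → r₁ ≤ r₂ → r₂ < 1 →
      2 ^ k * k * h r₂ ≤ -(N * log r₂) / 2 →
        N * log (r₂ / r₁) / 4 ≤ h r₁ + 2 ^ k * k * h r₂ := by
  obtain ⟨E, hE1, hEle, hE⟩ := hw.exists_energy hk hN hnorm
  have hc := cN_pos N k hk hN
  have hN0 : 0 < N := by omega
  set M : ℝ := ((N : ℝ) ^ k * cN N k) ^ ((1 : ℝ) / (k + 1)) with hM
  have hM0 : 0 ≤ M := by positivity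
  have hMk : M ^ (k + 1) = (N : ℝ) ^ k * cN N k := by
    rw [hM, ← rpow_natCast, ← rpow_mul (by positivity)]
    push_cast
    rw [one_div_mul_cancel (by positivity), rpow_one]
  have hMp : M ^ (((k : ℝ) + 1) / k) = muN N k := by
    rw [muN_eq N k hk hN, hM, ← rpow_mul (by positivity), mul_rpow (by positivity) hc.le,
      ← rpow_natCast, ← rpow_mul (by positivity)]
    congr 1
    · rw [show (k : ℝ) * (1 / (k + 1) * ((k + 1) / k)) = 1 by field_simp, rpow_one]
    · congr 1
      field_simp
  have hP : ∀ r, muN N k * |w r| ^ (((k : ℝ) + 1) / k) = (M * |w r|) ^ (((k : ℝ) + 1) / k) :=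
    fun r => by rw [mul_rpow hM0 (abs_nonneg _), hMp]
  have hE' : ∀ r₁ r₂, 0 < r₁ → r₁ ≤ r₂ → r₂ ≤ 1 →
      (M * |w r₁ - w r₂|) ^ (k + 1) ≤ (N * log (r₂ / r₁)) ^ k * (E r₁ - E r₂) :=
    fun r₁ r₂ h₁ h₁₂ h₂ => by
      rw [mul_pow, hMk, mul_assoc, mul_pow, mul_assoc]
      exact mul_le_mul_of_nonneg_left (hE r₁ r₂ h₁ h₁₂ h₂) (by positivity)
  have hE1' : ∀ r ∈ Ioo (0 : ℝ) 1, (M * |w r|) ^ (k + 1) ≤ (-(N * log r)) ^ k * E r :=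
    fun r hr => by
      have := hE' r 1 hr.1 hr.2.le le_rfl
      rwa [hw.bdry, hE1, one_div, log_inv, sub_zero, sub_zero, mul_neg] at this
  have hL : ∀ r ∈ Ioo (0 : ℝ) 1, 0 < -((N : ℝ) * log r) := fun r hr => by
    have := log_neg hr.1 hr.2
    have : (0 : ℝ) < N := by positivity
    nlinarith
  refine ⟨fun r hr => ?_, fun r₁ r₂ h₁ h₁₂ h₂ hε => ?_⟩
  · rw [hh, hP, sub_nonneg]
    refine le_of_pow_le_pow_left₀ hk.ne' (hL r hr).le ?_
    rw [rpow_succ_div_pow k hk (by positivity)]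
    exact (hE1' r hr).trans
      (mul_le_of_le_one_right (pow_nonneg (hL r hr).le _) (hEle r ⟨hr.1, hr.2.le⟩))
  · have hr₂ : r₂ ∈ Ioo (0 : ℝ) 1 := ⟨h₁.trans_le h₁₂, h₂⟩
    have hlog : 0 ≤ log (r₂ / r₁) := log_nonneg ((one_le_div h₁).2 h₁₂)
    have key := moser_two_point k hk (v₁ := M * |w r₁|) (v₂ := M * |w r₂|)
      (d := M * |w r₁ - w r₂|) (L := -(N * log r₂)) (y := N * log (r₂ / r₁)) (a := E r₂)
      (by positivity) (by positivity) (by positivity) (hL r₂ hr₂) (by positivity)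
      (hEle r₂ ⟨hr₂.1, h₂.le⟩)
      (by rw [← mul_add]
          gcongr
          simpa using abs_add_le (w r₂) (w r₁ - w r₂))
      (hE1' r₂ hr₂)
      ((hE' r₁ r₂ h₁ h₁₂ h₂.le).trans (by
        gcongr
        exact hEle r₁ ⟨h₁, h₁₂.trans h₂.le⟩))
      (by rwa [← hP, ← hh])
    rw [← hP, ← hP, ← hh r₂] at key
    refine key.trans_eq ?_
    rw [hh r₁, log_div hr₂.1.ne' h₁.ne']
    ring

/-- The Moser deficit `h` is either proportional to `-log r`, or grows linearly in the logarithmic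
distance to a single radius `ρ`. -/
theorem KAdmRad.exists_center {N k : ℕ} (hk : 0 < k) (hN : N = 2 * k) {w : ℝ → ℝ}
    (hw : KAdmRad N k w) (hnorm : normPhi N k w = 1) {h : ℝ → ℝ}
    (hh : ∀ r, h r = -(N * log r) - muN N k * |w r| ^ (((k : ℝ) + 1) / k)) :
    ∃ ρ > 0, ∀ r ∈ Ioo (0 : ℝ) 1, -(N * log r) / (2 * (2 ^ k * k)) ≤ h r ∨
      N / (4 * (1 + 2 ^ k * k)) * |log r - log ρ| - 1 ≤ h r := by
  obtain ⟨hnn, hpair⟩ := hw.deficit hk hN hnorm hh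
  set K : ℝ := 2 ^ k * k with hK
  have hK0 : 0 < K := by positivity
  set S : Set ℝ := {r ∈ Ioo (0 : ℝ) 1 | h r < -(N * log r) / (2 * K)} with hS
  rcases S.eq_empty_or_nonempty with hemp | hne
  · refine ⟨1, one_pos, fun r hr => Or.inl ?_⟩
    by_contra! hlt
    exact (hemp ▸ (⟨hr, hlt⟩ : r ∈ S) : r ∈ (∅ : Set ℝ))
  have hbdd : BddBelow (h '' S) := ⟨0, by rintro _ ⟨r, hr, rfl⟩; exact hnn r hr.1⟩
  obtain ⟨_, ⟨ρ, hρ, rfl⟩, hρmin⟩ := exists_lt_of_csInf_lt (hne.image h)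
    (lt_add_one (sInf (h '' S)))
  refine ⟨ρ, hρ.1.1, fun r hr => ?_⟩
  by_cases hrS : h r < -(N * log r) / (2 * K)
  swap
  · exact Or.inl (not_lt.1 hrS)
  right
  have hle : h ρ ≤ h r + 1 :=
    hρmin.le.trans (add_le_add_left (csInf_le hbdd ⟨r, ⟨hr, hrS⟩, rfl⟩) 1)
  have hS' : ∀ s ∈ S, K * h s ≤ -(N * log s) / 2 := fun s hs => by
    have := hs.2.le
    rw [le_div_iff₀ (by positivity)] at this
    linarith
  have main : N * |log r - log ρ| / 4 ≤ (1 + K) * h r + K + 1 := by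
    rcases le_total r ρ with hrρ | hρr
    · have := hpair r ρ hr.1 hrρ hρ.1.2 (hS' ρ hρ)
      rw [log_div hρ.1.1.ne' hr.1.ne'] at this
      rw [abs_sub_comm, abs_of_nonneg (sub_nonneg.2 (log_le_log hr.1 hrρ))]
      nlinarith
    · have := hpair ρ r hρ.1.1 hρr hr.2 (hS' r ⟨hr, hrS⟩)
      rw [log_div hr.1.ne' hρ.1.1.ne'] at this
      rw [abs_of_nonneg (sub_nonneg.2 (log_le_log hρ.1.1 hρr))]
      nlinarith
  have e : (N : ℝ) / (4 * (1 + K)) * |log r - log ρ| = (N * |log r - log ρ| / 4) / (1 + K) := by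
    field_simp
  rw [e, sub_le_iff_le_add, div_le_iff₀ (by positivity)]
  linarith

theorem lintegral_fun_norm_euclidean (N : ℕ) (hN : 0 < N) {F : ℝ → ℝ} (hF : ∀ y, 0 ≤ F y)
    (hint : IntegrableOn (fun y => y ^ (N - 1) * F y) (Ioi 0)) :
    ∫⁻ x : EuclideanSpace ℝ (Fin N), ENNReal.ofReal (F ‖x‖) =
      ENNReal.ofReal (omegaS N * ∫ y in Ioi (0 : ℝ), y ^ (N - 1) * F y) := by
  have : Nonempty (Fin N) := ⟨⟨0, hN⟩⟩
  have h := integral_fun_norm_addHaar (volume : Measure (EuclideanSpace ℝ (Fin N))) F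
  have hi : Integrable (fun x : EuclideanSpace ℝ (Fin N) => F ‖x‖) := by
    rw [integrable_fun_norm_addHaar]
    simpa using hint
  rw [← ofReal_integral_eq_lintegral_ofReal hi (Eventually.of_forall fun x => hF _), h]
  simp [omegaS, Measure.real, mul_assoc]

theorem lintegral_norm_rpow_Ioc (N : ℕ) (hN : 0 < N) {c R : ℝ} (hc : 0 < c) (hR : 0 < R) :
    ∫⁻ x : EuclideanSpace ℝ (Fin N),
      ENNReal.ofReal ((Ioc 0 R).indicator (fun y => y ^ (c - N)) ‖x‖) =
      ENNReal.ofReal (omegaS N * (R ^ c / c)) := by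
  have e : ∀ y, y ^ (N - 1) * (Ioc 0 R).indicator (fun y => y ^ (c - N)) y =
      (Ioc 0 R).indicator (fun y => y ^ (c - 1)) y := fun y => by
    by_cases hy : y ∈ Ioc 0 R
    · rw [indicator_of_mem hy, indicator_of_mem hy, ← rpow_natCast, ← rpow_add hy.1,
        Nat.cast_sub hN]
      congr 1
      push_cast
      ring
    · rw [indicator_of_notMem hy, indicator_of_notMem hy, mul_zero]
  have hi : IntegrableOn (fun y : ℝ => y ^ (c - 1)) (Ioc 0 R) :=
    (intervalIntegrable_iff_integrableOn_Ioc_of_le hR.le).1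
      (intervalIntegral.intervalIntegrable_rpow' (by linarith))
  have hsub : Ioc 0 R ∩ Ioi 0 = Ioc 0 R := inter_eq_left.2 fun y hy => hy.1
  rw [lintegral_fun_norm_euclidean N hN]
  · simp only [e]
    rw [setIntegral_indicator measurableSet_Ioc, inter_comm, hsub,
      ← intervalIntegral.integral_of_le hR.le, integral_rpow (Or.inl (by linarith)),
      sub_add_cancel, zero_rpow hc.ne', sub_zero]
  · exact fun y => indicator_nonneg (fun y hy => rpow_nonneg hy.1.le _) y
  · simp only [e]
    rw [IntegrableOn, integrable_indicator_iff measurableSet_Ioc, IntegrableOn,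
      Measure.restrict_restrict measurableSet_Ioc, hsub]
    exact hi

theorem lintegral_norm_rpow_Ioi (N : ℕ) (hN : 0 < N) {c R : ℝ} (hc : 0 < c) (hR : 0 < R) :
    ∫⁻ x : EuclideanSpace ℝ (Fin N),
      ENNReal.ofReal ((Ioi R).indicator (fun y => y ^ (-c - N)) ‖x‖) =
      ENNReal.ofReal (omegaS N * (R ^ (-c) / c)) := by
  have e : ∀ y, y ^ (N - 1) * (Ioi R).indicator (fun y => y ^ (-c - N)) y =
      (Ioi R).indicator (fun y => y ^ (-c - 1)) y := fun y => by
    by_cases hy : y ∈ Ioi R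
    · rw [indicator_of_mem hy, indicator_of_mem hy, ← rpow_natCast, ← rpow_add (hR.trans hy),
        Nat.cast_sub hN]
      congr 1
      push_cast
      ring
    · rw [indicator_of_notMem hy, indicator_of_notMem hy, mul_zero]
  have hsub : Ioi R ∩ Ioi 0 = Ioi R := inter_eq_left.2 fun y hy => hR.trans hy
  rw [lintegral_fun_norm_euclidean N hN]
  · simp only [e]
    rw [setIntegral_indicator measurableSet_Ioi, inter_comm, hsub,
      integral_Ioi_rpow_of_lt (by linarith) hR, sub_add_cancel, neg_div_neg_eq]
  · exact fun y => indicator_nonneg (fun y hy => rpow_nonneg (hR.trans hy).le _) y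
  · simp only [e]
    rw [IntegrableOn, integrable_indicator_iff measurableSet_Ioi, IntegrableOn,
      Measure.restrict_restrict measurableSet_Ioi, hsub]
    exact integrableOn_Ioi_rpow_of_lt (by linarith) hR

theorem exists_mul_abs_log_rpow_le {f : ℝ → ℝ} (hfc : ContinuousOn f (Ico 0 1)) {σ : ℝ}
    (hσ : IsBoundedUnder (· ≤ ·) (nhdsWithin (0 : ℝ) (Ioi 0)) (fun r => f r * |log r| ^ σ))
    (hσ0 : 0 ≤ σ) {R : ℝ} (hR : R < 1) :
    ∃ B : ℝ, 0 ≤ B ∧ ∀ r ∈ Ioc 0 R, f r * |log r| ^ σ ≤ B := by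
  obtain ⟨b, hb⟩ := hσ
  rw [eventually_map] at hb
  obtain ⟨ε, hε, hεb⟩ := mem_nhdsGT_iff_exists_Ioo_subset.1 hb
  have hε0 : (0 : ℝ) < ε := hε
  have hcont : ContinuousOn (fun r => f r * |log r| ^ σ) (Icc (ε / 2) R) := by
    refine (hfc.mono fun r hr => ⟨by linarith [hr.1], by linarith [hr.2]⟩).mul
      (((continuousOn_log.mono fun r hr => ?_).abs).rpow_const fun _ _ => Or.inr hσ0)
    exact ne_of_gt (by linarith [hr.1] : (0 : ℝ) < r)
  obtain ⟨b', hb'⟩ := isCompact_Icc.exists_bound_of_continuousOn hcont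
  refine ⟨max (max b b') 0, le_max_right _ _, fun r hr => le_max_of_le_left ?_⟩
  rcases lt_or_ge r ε with hlt | hge
  · exact le_max_of_le_left (hεb ⟨hr.1, hlt⟩)
  · exact le_max_of_le_right ((le_abs_self _).trans (hb' r ⟨by linarith, hr.2⟩))

/-- Under the decay condition on `f` at the origin, the supercritical perturbation of the exponent
changes `μ * x ^ p` by at most a constant, as long as `x` obeys the critical pointwise bound. -/
theorem exists_supercritical_perturbation_bound {f : ℝ → ℝ} (hfc : ContinuousOn f (Ico 0 1))
    (hfnn : ∀ r ∈ Ico (0 : ℝ) 1, 0 ≤ f r)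
    (hσ : ∃ σ : ℝ, 1 < σ ∧ IsBoundedUnder (· ≤ ·) (nhdsWithin (0 : ℝ) (Ioi 0))
      (fun r => f r * |log r| ^ σ)) {μ n p : ℝ} (hμ : 0 < μ) (hn : 0 < n) (hp : 0 < p) :
    ∃ C : ℝ, ∀ r ∈ Ioo (0 : ℝ) 1, ∀ x : ℝ, 0 ≤ x → μ * x ^ p ≤ -(n * log r) →
      μ * x ^ (p + f r) ≤ μ * x ^ p + C := by
  obtain ⟨σ, hσ1, hσb⟩ := hσ
  set D := n / μ with hD
  have hD0 : 0 < D := by positivity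
  obtain ⟨B, hB0, hB⟩ := exists_mul_abs_log_rpow_le hfc hσb (by linarith)
    (R := exp (-(1 / D))) (exp_zero ▸ exp_lt_exp.2 (neg_lt_zero.2 (by positivity)))
  set B' := B * (D ^ (σ - 1) / ((σ - 1) * p)) with hB'
  have hσ' : 0 < σ - 1 := sub_pos.2 hσ1
  have hB'0 : 0 ≤ B' := by positivity
  refine ⟨n * B' * exp (B' * D), fun r hr x hx hxr => ?_⟩
  have hf := hfnn r ⟨hr.1.le, hr.2⟩
  have hC0 : 0 ≤ n * B' * exp (B' * D) := by positivity
  rw [rpow_add_of_nonneg hx hp.le hf]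
  have hxp : 0 ≤ x ^ p := by positivity
  rcases le_or_gt x 1 with hx1 | hx1
  · have : x ^ p * x ^ f r ≤ x ^ p := mul_le_of_le_one_right hxp (rpow_le_one hx hx1 hf)
    nlinarith
  set l := -log r with hl
  have hl0 : 0 < l := neg_pos.2 (log_neg hr.1 hr.2)
  have habs : |log r| = l := abs_of_neg (log_neg hr.1 hr.2)
  have hnl : -(n * log r) = n * l := by rw [hl]; ring
  have hxD : x ^ p ≤ D * l := by
    rw [hD, div_mul_eq_mul_div, le_div_iff₀ hμ, ← hnl]
    linarith
  have hDl : 1 ≤ D * l := (one_lt_rpow hx1 hp).le.trans hxD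
  have hrR : r ∈ Ioc 0 (exp (-(1 / D))) := by
    refine ⟨hr.1, ?_⟩
    rw [← log_le_iff_le_exp hr.1]
    have : 1 / D ≤ l := by rw [div_le_iff₀ hD0]; linarith
    linarith
  have hfl := hB r hrR
  rw [habs] at hfl
  have hlogx : log x ≤ D ^ (σ - 1) / ((σ - 1) * p) * l ^ (σ - 1) := by
    have h₁ : p * log x ≤ log (D * l) := by
      rw [← log_rpow (by linarith)]
      exact log_le_log (by positivity) hxD
    have h₂ := log_le_rpow_div (x := D * l) (by positivity) hσ'
    rw [mul_rpow hD0.le hl0.le] at h₂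
    have e : D ^ (σ - 1) / ((σ - 1) * p) * l ^ (σ - 1) =
        D ^ (σ - 1) * l ^ (σ - 1) / (σ - 1) / p := by field_simp
    rw [e, le_div_iff₀ hp]
    linarith
  set X := log x * f r with hX
  have hX0 : 0 ≤ X := mul_nonneg (log_nonneg hx1.le) hf
  have hXl : X * l ≤ B' := by
    calc X * l ≤ D ^ (σ - 1) / ((σ - 1) * p) * l ^ (σ - 1) * f r * l := by rw [hX]; gcongr
      _ = f r * (l ^ (σ - 1) * l) * (D ^ (σ - 1) / ((σ - 1) * p)) := by ring
      _ = f r * l ^ σ * (D ^ (σ - 1) / ((σ - 1) * p)) := by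
        rw [← rpow_add_one hl0.ne', sub_add_cancel]
      _ ≤ B' := by rw [hB']; gcongr
  have hXD : X ≤ B' * D := by
    calc X ≤ X * (D * l) := le_mul_of_one_le_right hX0 hDl
      _ = X * l * D := by ring
      _ ≤ B' * D := by gcongr
  have hexp : exp X ≤ 1 + X * exp X := by
    have h₁ := add_one_le_exp (-X)
    have h₂ : exp (-X) * exp X = 1 := by rw [← exp_add, neg_add_cancel, exp_zero]
    nlinarith [exp_pos X]
  rw [rpow_def_of_pos (by linarith : 0 < x) (f r), ← hX, ← mul_assoc]
  calc μ * x ^ p * exp X ≤ μ * x ^ p * (1 + X * exp X) := by gcongr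
    _ = μ * x ^ p + μ * x ^ p * (X * exp X) := by ring
    _ ≤ μ * x ^ p + n * l * (X * exp X) := by
      have := mul_le_mul_of_nonneg_right (hnl ▸ hxr) (mul_nonneg hX0 (exp_pos X).le)
      linarith
    _ = μ * x ^ p + n * (X * l) * exp X := by ring
    _ ≤ μ * x ^ p + n * B' * exp (B' * D) := by gcongr

/-- A radial majorant of Moser-type exponentials, concentrated near radius `ρ` up to a fixed term. -/
noncomputable def moserMajorant (N : ℕ) (a c ρ : ℝ) (r : ℝ) : ℝ :=
  (Ioc 0 1).indicator (fun y => y ^ (a - N)) r +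
    (exp 1 * ρ ^ (-c) * (Ioc 0 ρ).indicator (fun y => y ^ (c - N)) r +
      exp 1 * ρ ^ c * (Ioi ρ).indicator (fun y => y ^ (-c - N)) r)

theorem lintegral_moserMajorant (N : ℕ) (hN : 0 < N) {a c ρ : ℝ} (ha : 0 < a) (hc : 0 < c)
    (hρ : 0 < ρ) :
    ∫⁻ x : EuclideanSpace ℝ (Fin N), ENNReal.ofReal (moserMajorant N a c ρ ‖x‖) =
      ENNReal.ofReal (omegaS N * (1 ^ a / a)) +
        (ENNReal.ofReal (exp 1 * (omegaS N / c)) + ENNReal.ofReal (exp 1 * (omegaS N / c))) := by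
  have hmeas : ∀ (s : Set ℝ) (q : ℝ), MeasurableSet s → Measurable
      (fun x : EuclideanSpace ℝ (Fin N) => ENNReal.ofReal (s.indicator (fun y => y ^ q) ‖x‖)) :=
    fun s q hs => (((measurable_id.pow_const q).indicator hs).comp measurable_norm).ennreal_ofReal
  have hA : ∀ R q y : ℝ, 0 ≤ (Ioc 0 R).indicator (fun y => y ^ q) y := fun R q y =>
    indicator_nonneg (fun y hy => rpow_nonneg hy.1.le _) y
  have hB : ∀ q y : ℝ, 0 ≤ (Ioi ρ).indicator (fun y => y ^ q) y := fun q y =>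
    indicator_nonneg (fun y hy => rpow_nonneg (hρ.trans hy).le _) y
  have e : ∀ r, ENNReal.ofReal (moserMajorant N a c ρ r) =
      ENNReal.ofReal ((Ioc 0 1).indicator (fun y => y ^ (a - N)) r) +
      (ENNReal.ofReal (exp 1 * ρ ^ (-c)) *
          ENNReal.ofReal ((Ioc 0 ρ).indicator (fun y => y ^ (c - N)) r) +
        ENNReal.ofReal (exp 1 * ρ ^ c) *
          ENNReal.ofReal ((Ioi ρ).indicator (fun y => y ^ (-c - N)) r)) := fun r => by
    have h₂ := mul_nonneg (show 0 ≤ exp 1 * ρ ^ (-c) by positivity) (hA ρ (c - N) r)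
    have h₃ := mul_nonneg (show 0 ≤ exp 1 * ρ ^ c by positivity) (hB (-c - N) r)
    rw [moserMajorant, ENNReal.ofReal_add (hA _ _ _) (add_nonneg h₂ h₃), ENNReal.ofReal_add h₂ h₃,
      ENNReal.ofReal_mul (show 0 ≤ exp 1 * ρ ^ (-c) by positivity),
      ENNReal.ofReal_mul (show 0 ≤ exp 1 * ρ ^ c by positivity)]
  have hω : 0 ≤ omegaS N := by unfold omegaS; positivity
  simp only [e]
  rw [lintegral_add_left (hmeas _ _ measurableSet_Ioc),
    lintegral_add_left ((hmeas _ _ measurableSet_Ioc).const_mul _),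
    lintegral_const_mul' _ _ ENNReal.ofReal_ne_top,
    lintegral_const_mul' _ _ ENNReal.ofReal_ne_top,
    lintegral_norm_rpow_Ioc N hN ha one_pos, lintegral_norm_rpow_Ioc N hN hc hρ,
    lintegral_norm_rpow_Ioi N hN hc hρ, ← ENNReal.ofReal_mul (by positivity),
    ← ENNReal.ofReal_mul (by positivity), rpow_neg hρ.le]
  have hρc : ρ ^ c ≠ 0 := (rpow_pos_of_pos hρ c).ne'
  congr 3 <;> field_simp

theorem exp_le_moserMajorant {N : ℕ} {a c ρ r h : ℝ} (hρ : 0 < ρ) (hr : r ∈ Ioo (0 : ℝ) 1)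
    (hh : -(a * log r) ≤ h ∨ c * |log r - log ρ| - 1 ≤ h) :
    exp (-(N * log r) - h) ≤ moserMajorant N a c ρ r := by
  have hA : ∀ R q y : ℝ, 0 ≤ (Ioc 0 R).indicator (fun y => y ^ q) y := fun R q y =>
    indicator_nonneg (fun y hy => rpow_nonneg hy.1.le _) y
  have hB : ∀ q y : ℝ, 0 ≤ (Ioi ρ).indicator (fun y => y ^ q) y := fun q y =>
    indicator_nonneg (fun y hy => rpow_nonneg (hρ.trans hy).le _) y
  have h₁ := hA 1 (a - N) r
  have h₂ := mul_nonneg (show 0 ≤ exp 1 * ρ ^ (-c) by positivity) (hA ρ (c - N) r)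
  have h₃ := mul_nonneg (show 0 ≤ exp 1 * ρ ^ c by positivity) (hB (-c - N) r)
  rw [moserMajorant]
  rcases hh with hh | hh
  · refine le_trans ?_ (le_add_of_nonneg_right (add_nonneg h₂ h₃))
    rw [indicator_of_mem (show r ∈ Ioc 0 1 from ⟨hr.1, hr.2.le⟩), rpow_def_of_pos hr.1, exp_le_exp]
    linarith
  refine le_trans ?_ (le_add_of_nonneg_left h₁)
  rcases le_or_gt r ρ with hrρ | hρr
  · refine le_trans ?_ (le_add_of_nonneg_right h₃)
    rw [indicator_of_mem (show r ∈ Ioc 0 ρ from ⟨hr.1, hrρ⟩), rpow_def_of_pos hr.1,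
      rpow_def_of_pos hρ, ← exp_add, ← exp_add, exp_le_exp]
    rw [abs_sub_comm, abs_of_nonneg (sub_nonneg.2 (log_le_log hr.1 hrρ))] at hh
    linarith
  · refine le_trans ?_ (le_add_of_nonneg_left h₂)
    rw [indicator_of_mem (show r ∈ Ioi ρ from hρr), rpow_def_of_pos hr.1,
      rpow_def_of_pos hρ, ← exp_add, ← exp_add, exp_le_exp]
    rw [abs_of_nonneg (sub_nonneg.2 (log_le_log hρ hρr.le))] at hh
    linarith

theorem stmt0 (N k : ℕ) (hk : 0 < k) (hN : N = 2 * k)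
    (f : ℝ → ℝ) (hfc : ContinuousOn f (Ico 0 1)) (hf0 : f 0 = 0)
    (hfpos : ∀ r ∈ Ioo (0:ℝ) 1, 0 < f r) (hfnn : ∀ r ∈ Ico (0:ℝ) 1, 0 ≤ f r)
    (hσ : ∃ σ : ℝ, 1 < σ ∧ IsBoundedUnder (· ≤ ·) (nhdsWithin (0:ℝ) (Ioi 0))
      (fun r => f r * |log r| ^ σ))
    :
    (⨆ w : {w : ℝ → ℝ // KAdmRad N k w ∧ normPhi N k w = 1},
      ballIntegral N k f w.1) < ⊤ := by
  have hN0 : 0 < N := by omega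
  have hNR : (0 : ℝ) < N := by positivity
  have : Nonempty (Fin N) := ⟨⟨0, hN0⟩⟩
  have hp : ((N : ℝ) + 2) / N = ((k : ℝ) + 1) / k := by
    subst hN
    push_cast
    field_simp
  obtain ⟨C, hC⟩ := exists_supercritical_perturbation_bound hfc hfnn hσ (muN_pos N k hk hN) hNR
    (p := ((k : ℝ) + 1) / k) (by positivity)
  obtain ⟨a, ha⟩ : ∃ a : ℝ, a = N / (2 * (2 ^ k * k)) := ⟨_, rfl⟩
  obtain ⟨c, hc⟩ : ∃ c : ℝ, c = N / (4 * (1 + 2 ^ k * k)) := ⟨_, rfl⟩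
  have ha0 : 0 < a := by rw [ha]; positivity
  have hc0 : 0 < c := by rw [hc]; positivity
  suffices hle : ∃ T < ⊤, ∀ w, KAdmRad N k w → normPhi N k w = 1 → ballIntegral N k f w ≤ T by
    obtain ⟨T, hT, hle⟩ := hle
    exact lt_of_le_of_lt (iSup_le fun w => hle w.1 w.2.1 w.2.2) hT
  refine ⟨ENNReal.ofReal (exp C) * (ENNReal.ofReal (omegaS N * (1 ^ a / a)) +
    (ENNReal.ofReal (exp 1 * (omegaS N / c)) + ENNReal.ofReal (exp 1 * (omegaS N / c)))), ?_, ?_⟩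
  · finiteness
  intro w hw hnorm
  obtain ⟨h, hh⟩ : ∃ h : ℝ → ℝ, ∀ r,
      h r = -(N * log r) - muN N k * |w r| ^ (((k : ℝ) + 1) / k) := ⟨_, fun _ => rfl⟩
  have hnn := (hw.deficit hk hN hnorm hh).1
  obtain ⟨ρ, hρ, hcenter⟩ := hw.exists_center hk hN hnorm hh
  rw [← hc] at hcenter
  have hpt : ∀ r ∈ Ioo (0 : ℝ) 1, exp (muN N k * |w r| ^ (((N : ℝ) + 2) / N + f r)) ≤
      exp C * moserMajorant N a c ρ r := fun r hr => by
    have h₁ := hC r hr |w r| (abs_nonneg _) (sub_nonneg.1 (hh r ▸ hnn r hr))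
    have h₂ := exp_le_moserMajorant (N := N) (a := a) hρ hr ((hcenter r hr).imp_left fun h₂ => by
      rwa [ha, div_mul_eq_mul_div, ← neg_div])
    rw [hh, sub_sub_cancel] at h₂
    rw [hp]
    refine (exp_le_exp.2 h₁).trans ?_
    rw [add_comm, exp_add]
    gcongr
  have hne : ∀ᵐ x : EuclideanSpace ℝ (Fin N), x ≠ 0 := by
    simp [ae_iff, measure_singleton]
  calc ballIntegral N k f w
      ≤ ∫⁻ x in Metric.ball (0 : EuclideanSpace ℝ (Fin N)) 1,
          ENNReal.ofReal (exp C) * ENNReal.ofReal (moserMajorant N a c ρ ‖x‖) := by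
        refine lintegral_mono_ae ?_
        filter_upwards [ae_restrict_mem measurableSet_ball, ae_restrict_of_ae hne] with x hx hx0
        rw [← ENNReal.ofReal_mul (exp_pos C).le]
        exact ENNReal.ofReal_le_ofReal (hpt ‖x‖ ⟨norm_pos_iff.2 hx0, by simpa using hx⟩)
    _ ≤ ∫⁻ x : EuclideanSpace ℝ (Fin N),
          ENNReal.ofReal (exp C) * ENNReal.ofReal (moserMajorant N a c ρ ‖x‖) :=
        setLIntegral_le_lintegral _ _
    _ = _ := by
        rw [lintegral_const_mul' _ _ ENNReal.ofReal_ne_top,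
          lintegral_moserMajorant N hN0 ha0 hc0 hρ]
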